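/- (Refined bilinear L² estimate for free Klein–Gordon waves, comparable frequencies; Proposition 5.2, second case.) For every T > 0 there exists a constant C_T > 0 such that for all M, N, O ≥ 1 with N/2 ≤ M ≤ 2N, all signs σ₁, σ₂ ∈ {+1, −1} and all complex coefficients (a(m))_{m ∈ S_M}, (b(n))_{n ∈ S_N}, the corresponding free Klein–Gordon waves u, v satisfy ‖P_O(uv)‖_{L²([0,T] × T³)} ≤ C_T · max(O, M, N)^{1/2} · min(O, M, N)^{1/2} · (∑_{m ∈ S_M} |a(m)|²)^{1/2} (∑_{n ∈ S_N} |b(n)|²)^{1/2}. -/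

import Mathlib

open MeasureTheory

/-- The torus `T³`, realized as the cube `[0, 2π)³` in `ℝ³` (with Lebesgue measure). -/
noncomputable def cube : Set (Fin 3 → ℝ) := Set.univ.pi fun _ => Set.Ico (0:ℝ) (2 * Real.pi)

/-- The Euclidean norm `|n|` of a lattice point `n ∈ ℤ³`. -/
noncomputable def normZ (n : Fin 3 → ℤ) : ℝ := Real.sqrt (∑ i, ((n i : ℝ)) ^ 2)

/-- The Japanese bracket `⟨n⟩ = (1 + |n|²)^{1/2}` of a lattice point `n ∈ ℤ³`. -/
noncomputable def jbZ (n : Fin 3 → ℤ) : ℝ := Real.sqrt (1 + ∑ i, ((n i : ℝ)) ^ 2)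

/-- The Euclidean inner product `n·x` for `n ∈ ℤ³`, `x ∈ ℝ³`. -/
noncomputable def dotZ (n : Fin 3 → ℤ) (x : Fin 3 → ℝ) : ℝ := ∑ i, (n i : ℝ) * x i

open scoped Classical in
/-- The dyadic annulus `S_N = {n ∈ ℤ³ : N ≤ |n| < 2N}`, as a finite set of lattice points. -/
noncomputable def annulus (N : ℝ) : Finset (Fin 3 → ℤ) :=
  (Finset.Icc (fun _ => -⌈2 * N⌉) fun _ => ⌈2 * N⌉).filter fun n =>
    N ≤ normZ n ∧ normZ n < 2 * N

open scoped Classical in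
/-- The frequency projection `P_O(uv)` of the product of the free Klein–Gordon waves
`u(t,x) = ∑_{m ∈ S_M} a(m) exp(i(m·x + σ₁ t⟨m⟩))` and
`v(t,x) = ∑_{n ∈ S_N} b(n) exp(i(n·x + σ₂ t⟨n⟩))`:
`P_O(uv)(t,x) = ∑_{k ∈ S_O} (∑_{m ∈ S_M, n ∈ S_N, m+n=k} a(m) b(n) e^{it(σ₁⟨m⟩+σ₂⟨n⟩)}) e^{ik·x}`. -/
noncomputable def projProdWave (O M N : ℝ) (σ₁ σ₂ : ℝ) (a b : (Fin 3 → ℤ) → ℂ)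
    (t : ℝ) (x : Fin 3 → ℝ) : ℂ :=
  ∑ k ∈ annulus O,
    (∑ m ∈ annulus M, ∑ n ∈ annulus N,
      if m + n = k then
        a m * b n * Complex.exp (Complex.I * ((t * (σ₁ * jbZ m + σ₂ * jbZ n) : ℝ) : ℂ))
      else 0) *
    Complex.exp (Complex.I * ((dotZ k x : ℝ) : ℂ))

lemma sqrt_sum_sq_add_le (a b c a' b' c' : ℝ) :
    √((a + a') ^ 2 + (b + b') ^ 2 + (c + c') ^ 2) ≤
      √(a ^ 2 + b ^ 2 + c ^ 2) + √(a' ^ 2 + b' ^ 2 + c' ^ 2) := by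
  simpa [EuclideanSpace.norm_eq, Fin.sum_univ_three] using
    norm_add_le (!₂[a, b, c] : EuclideanSpace ℝ (Fin 3)) !₂[a', b', c']

open scoped Pointwise in
/-- A shell of width `w` of a function that is star-convex and quadratically coercive on a square
has area `O(w / c)`, uniformly in its height. -/
lemma volume_shell_le {h : ℝ × ℝ → ℝ} (hm : Measurable h) {c ρ w : ℝ} (τ : ℝ) (hc : 0 < c)
    (hw : 0 < w) (hray : ∀ q, ∀ s : ℝ, 0 ≤ s → s ≤ 1 → h (s • q) ≤ s * h q)
    (hlow : ∀ q : ℝ × ℝ, |q.1| ≤ ρ → |q.2| ≤ ρ → c * (q.1 ^ 2 + q.2 ^ 2) ≤ h q) :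
    volume {q : ℝ × ℝ | |q.1| ≤ ρ ∧ |q.2| ≤ ρ ∧ τ < h q ∧ h q ≤ τ + w} ≤
      ENNReal.ofReal (8 * w / c) := by
  let K : ℝ → Set (ℝ × ℝ) := fun a => {q | |q.1| ≤ ρ ∧ |q.2| ≤ ρ ∧ h q ≤ a}
  have hKm : ∀ a, MeasurableSet (K a) := fun a => by
    have h1 : Continuous fun q : ℝ × ℝ => |q.1| := by fun_prop
    have h2 : Continuous fun q : ℝ × ℝ => |q.2| := by fun_prop
    exact (measurableSet_le h1.measurable measurable_const).inter
      ((measurableSet_le h2.measurable measurable_const).inter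
        (measurableSet_le hm measurable_const))
  have hK : ∀ a, 0 ≤ a → volume (K a) ≤ ENNReal.ofReal (4 * a / c) := by
    intro a ha
    have hsub : K a ⊆ Set.Icc (-√(a / c)) (√(a / c)) ×ˢ Set.Icc (-√(a / c)) (√(a / c)) := by
      rintro q ⟨h1, h2, h3⟩
      have h4 := (hlow q h1 h2).trans h3
      have h5 : q.1 ^ 2 + q.2 ^ 2 ≤ a / c := by rw [le_div_iff₀ hc]; linarith
      have h6 : |q.1| ≤ √(a / c) := Real.abs_le_sqrt (by nlinarith [sq_nonneg q.2])
      have h7 : |q.2| ≤ √(a / c) := Real.abs_le_sqrt (by nlinarith [sq_nonneg q.1])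
      exact ⟨abs_le.1 h6, abs_le.1 h7⟩
    refine (measure_mono hsub).trans ?_
    rw [Measure.volume_eq_prod, Measure.prod_prod, Real.volume_Icc,
      ← ENNReal.ofReal_mul (by linarith [Real.sqrt_nonneg (a / c)])]
    refine ENNReal.ofReal_le_ofReal ?_
    have := Real.mul_self_sqrt (div_nonneg ha hc.le)
    rw [mul_div_assoc]
    linarith
  have hS : {q : ℝ × ℝ | |q.1| ≤ ρ ∧ |q.2| ≤ ρ ∧ τ < h q ∧ h q ≤ τ + w} = K (τ + w) \ K τ := by
    ext q
    simp only [Set.mem_ofPred_eq, Set.mem_sdiff, K]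
    constructor
    · rintro ⟨h1, h2, h3, h4⟩
      exact ⟨⟨h1, h2, h4⟩, fun h5 => absurd h5.2.2 (not_le.2 h3)⟩
    · rintro ⟨⟨h1, h2, h4⟩, h5⟩
      exact ⟨h1, h2, not_le.1 fun h6 => h5 ⟨h1, h2, h6⟩, h4⟩
  rw [hS]
  rcases le_or_gt τ 0 with h0 | h0
  · calc volume (K (τ + w) \ K τ) ≤ volume (K w) := by
          refine measure_mono fun q hq => ?_
          obtain ⟨⟨h1, h2, h4⟩, -⟩ := hq
          exact ⟨h1, h2, by linarith⟩
      _ ≤ _ := (hK w hw.le).trans (ENNReal.ofReal_le_ofReal (by gcongr; norm_num))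
  · have hsub : K τ ⊆ K (τ + w) := fun q hq => ⟨hq.1, hq.2.1, by linarith [hq.2.2]⟩
    have hfin : ∀ a, 0 ≤ a → volume (K a) ≠ ⊤ := fun a ha =>
      ((hK a ha).trans_lt ENNReal.ofReal_lt_top).ne
    rw [measure_sdiff hsub (hKm τ).nullMeasurableSet (hfin τ h0.le)]
    have hs0 : 0 < τ / (τ + w) := by positivity
    have hs1 : τ / (τ + w) ≤ 1 := by rw [div_le_one (by positivity)]; linarith
    set s := τ / (τ + w) with hs
    have hsc : s • K (τ + w) ⊆ K τ := by
      rintro _ ⟨q, ⟨h1, h2, h3⟩, rfl⟩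
      refine ⟨?_, ?_, ?_⟩
      · simp only [Prod.smul_fst, smul_eq_mul, abs_mul, abs_of_pos hs0]
        nlinarith [abs_nonneg q.1]
      · simp only [Prod.smul_snd, smul_eq_mul, abs_mul, abs_of_pos hs0]
        nlinarith [abs_nonneg q.2]
      · calc h (s • q) ≤ s * h q := hray q s hs0.le hs1
          _ ≤ s * (τ + w) := by gcongr
          _ = τ := by rw [hs]; field_simp
    have hvol := measure_mono (μ := volume) hsc
    rw [Measure.addHaar_smul] at hvol
    have hdim : Module.finrank ℝ (ℝ × ℝ) = 2 := by simp
    rw [hdim, abs_of_nonneg (by positivity)] at hvol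
    have e1 := hfin (τ + w) (by positivity)
    have e2 := hfin τ h0.le
    have hb := hK (τ + w) (by positivity)
    rw [← ENNReal.ofReal_toReal e1] at hvol hb ⊢
    rw [← ENNReal.ofReal_toReal e2] at hvol ⊢
    rw [← ENNReal.ofReal_mul (by positivity)] at hvol
    rw [ENNReal.ofReal_le_ofReal_iff (by positivity)] at hvol hb
    rw [← ENNReal.ofReal_sub _ (by positivity)]
    refine ENNReal.ofReal_le_ofReal ?_
    set V := (volume (K (τ + w))).toReal
    have hV : 0 ≤ V := ENNReal.toReal_nonneg
    have : V - s ^ 2 * V ≤ 2 * (1 - s) * V := by nlinarith [mul_nonneg hV (sq_nonneg (1 - s))]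
    calc V - (volume (K τ)).toReal ≤ 2 * (1 - s) * V := by linarith
      _ ≤ 2 * (1 - s) * (4 * (τ + w) / c) := by gcongr
      _ = 8 * w / c := by rw [hs]; field_simp; ring

lemma card_le_volume_of_unit_squares (P : Finset (ℤ × ℤ)) (p₀ : ℝ × ℝ) (S : Set (ℝ × ℝ))
    (hS : ∀ p ∈ P, ∀ x y : ℝ, 0 ≤ x → x < 1 → 0 ≤ y → y < 1 →
      ((p.1 + x - p₀.1, p.2 + y - p₀.2) : ℝ × ℝ) ∈ S) :
    (P.card : ENNReal) ≤ volume S := by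
  let B : ℤ × ℤ → Set (ℝ × ℝ) := fun p =>
    Set.Ico (p.1 - p₀.1) (p.1 - p₀.1 + 1) ×ˢ Set.Ico (p.2 - p₀.2) (p.2 - p₀.2 + 1)
  have hB : ∀ p, volume (B p) = 1 := fun p => by
    simp [B, Measure.volume_eq_prod, Measure.prod_prod, Real.volume_Ico]
  have hd : Set.PairwiseDisjoint (P : Set (ℤ × ℤ)) B := by
    intro p _ p' _ hne
    refine Set.disjoint_left.2 fun z hz hz' => hne ?_
    obtain ⟨⟨h1, h2⟩, h3, h4⟩ := hz
    obtain ⟨⟨h1', h2'⟩, h3', h4'⟩ := hz'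
    have a1 : (p.1 : ℝ) < p'.1 + 1 := by linarith
    have a2 : (p'.1 : ℝ) < p.1 + 1 := by linarith
    have a3 : (p.2 : ℝ) < p'.2 + 1 := by linarith
    have a4 : (p'.2 : ℝ) < p.2 + 1 := by linarith
    norm_cast at a1 a2 a3 a4
    ext <;> omega
  calc (P.card : ENNReal) = ∑ p ∈ P, volume (B p) := by simp [hB]
    _ = volume (⋃ p ∈ P, B p) :=
      (measure_biUnion_finset hd fun p _ => measurableSet_Ico.prod measurableSet_Ico).symm
    _ ≤ volume S := by
      refine measure_mono (Set.iUnion₂_subset fun p hp z hz => ?_)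
      obtain ⟨⟨h1, h2⟩, h3, h4⟩ := hz
      have := hS p hp (z.1 - (p.1 - p₀.1)) (z.2 - (p.2 - p₀.2)) (by linarith) (by linarith)
        (by linarith) (by linarith)
      convert this using 1
      ext <;> ring

/-- The function `p ↦ |(A, p)| + |(B, κ - p)|` on the plane. -/
noncomputable def focalSum (A B : ℝ) (κ p : ℝ × ℝ) : ℝ :=
  √(A ^ 2 + p.1 ^ 2 + p.2 ^ 2) + √(B ^ 2 + (κ.1 - p.1) ^ 2 + (κ.2 - p.2) ^ 2)

lemma sqrt_sum_sq_smul {s : ℝ} (hs : 0 ≤ s) (a b c : ℝ) :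
    √((s * a) ^ 2 + (s * b) ^ 2 + (s * c) ^ 2) = s * √(a ^ 2 + b ^ 2 + c ^ 2) := by
  rw [show (s * a) ^ 2 + (s * b) ^ 2 + (s * c) ^ 2 = s ^ 2 * (a ^ 2 + b ^ 2 + c ^ 2) by ring,
    Real.sqrt_mul (sq_nonneg s), Real.sqrt_sq hs]

lemma sqrt_sum_sq_convex {s : ℝ} (hs0 : 0 ≤ s) (hs1 : s ≤ 1) (a b c b' c' : ℝ) :
    √(a ^ 2 + ((1 - s) * b + s * b') ^ 2 + ((1 - s) * c + s * c') ^ 2) ≤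
      (1 - s) * √(a ^ 2 + b ^ 2 + c ^ 2) + s * √(a ^ 2 + b' ^ 2 + c' ^ 2) := by
  have h := sqrt_sum_sq_add_le ((1 - s) * a) ((1 - s) * b) ((1 - s) * c) (s * a) (s * b') (s * c')
  rwa [sqrt_sum_sq_smul hs0, sqrt_sum_sq_smul (by linarith),
    show (1 - s) * a + s * a = a by ring] at h

lemma sqrt_sum_sq_lipschitz (a b c b' c' : ℝ) :
    √(a ^ 2 + b ^ 2 + c ^ 2) ≤ √(a ^ 2 + b' ^ 2 + c' ^ 2) + (|b - b'| + |c - c'|) := by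
  have h := sqrt_sum_sq_add_le a b' c' 0 (b - b') (c - c')
  have h2 : √(0 ^ 2 + (b - b') ^ 2 + (c - c') ^ 2) ≤ |b - b'| + |c - c'| := by
    refine Real.sqrt_le_iff.2 ⟨by positivity, ?_⟩
    nlinarith [sq_abs (b - b'), sq_abs (c - c'),
      mul_nonneg (abs_nonneg (b - b')) (abs_nonneg (c - c'))]
  rw [add_zero, add_sub_cancel, add_sub_cancel] at h
  linarith

lemma focalSum_convex {s : ℝ} (hs0 : 0 ≤ s) (hs1 : s ≤ 1) (A B : ℝ) (κ p p' : ℝ × ℝ) :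
    focalSum A B κ ((1 - s) • p + s • p') ≤
      (1 - s) * focalSum A B κ p + s * focalSum A B κ p' := by
  have h1 := sqrt_sum_sq_convex hs0 hs1 A p.1 p.2 p'.1 p'.2
  have h2 := sqrt_sum_sq_convex hs0 hs1 B (κ.1 - p.1) (κ.2 - p.2) (κ.1 - p'.1) (κ.2 - p'.2)
  have e1 : κ.1 - ((1 - s) * p.1 + s * p'.1) = (1 - s) * (κ.1 - p.1) + s * (κ.1 - p'.1) := by ring
  have e2 : κ.2 - ((1 - s) * p.2 + s * p'.2) = (1 - s) * (κ.2 - p.2) + s * (κ.2 - p'.2) := by ring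
  simp only [focalSum, Prod.fst_add, Prod.snd_add, Prod.smul_fst, Prod.smul_snd, smul_eq_mul,
    e1, e2]
  linarith

lemma focalSum_lipschitz (A B : ℝ) (κ p p' : ℝ × ℝ) :
    focalSum A B κ p ≤ focalSum A B κ p' + 2 * (|p.1 - p'.1| + |p.2 - p'.2|) := by
  have h1 := sqrt_sum_sq_lipschitz A p.1 p.2 p'.1 p'.2
  have h2 := sqrt_sum_sq_lipschitz B (κ.1 - p.1) (κ.2 - p.2) (κ.1 - p'.1) (κ.2 - p'.2)
  rw [show κ.1 - p.1 - (κ.1 - p'.1) = -(p.1 - p'.1) by ring, abs_neg,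
    show κ.2 - p.2 - (κ.2 - p'.2) = -(p.2 - p'.2) by ring, abs_neg] at h2
  simp only [focalSum]
  linarith

lemma focalSum_center {A B : ℝ} (hA : 0 < A) (hB : 0 < B) (κ : ℝ × ℝ) :
    focalSum A B κ ((A / (A + B)) • κ) = √((A + B) ^ 2 + κ.1 ^ 2 + κ.2 ^ 2) := by
  have h1 := sqrt_sum_sq_smul (s := A / (A + B)) (by positivity) (A + B) κ.1 κ.2
  have h2 := sqrt_sum_sq_smul (s := B / (A + B)) (by positivity) (A + B) κ.1 κ.2
  have hAB : A + B ≠ 0 := by positivity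
  have e1 : A / (A + B) * (A + B) = A := by field_simp
  have e2 : B / (A + B) * (A + B) = B := by field_simp
  have e3 : ∀ x : ℝ, x - A / (A + B) * x = B / (A + B) * x := fun x => by field_simp; ring
  rw [e1] at h1
  rw [e2] at h2
  simp only [focalSum, Prod.smul_fst, Prod.smul_snd, smul_eq_mul, e3, h1, h2]
  field_simp

/-- Quadratic coercivity of `focalSum` around its minimizer. -/
lemma focalSum_lower {A B : ℝ} (hA : 0 < A) (hB : 0 < B) (κ q : ℝ × ℝ) {V L : ℝ}
    (hL : L = √((A + B) ^ 2 + κ.1 ^ 2 + κ.2 ^ 2))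
    (hV : V = √(A ^ 2 + (A / (A + B) * κ.1 + q.1) ^ 2 + (A / (A + B) * κ.2 + q.2) ^ 2)) :
    (A + B) ^ 2 / (2 * V * L ^ 2) * (q.1 ^ 2 + q.2 ^ 2) ≤
      focalSum A B κ ((A / (A + B)) • κ + q) - L := by
  have hAB : 0 < A + B := by positivity
  obtain ⟨p, hp⟩ : ∃ p : ℝ × ℝ, p = (A / (A + B)) • κ + q := ⟨_, rfl⟩
  have hp1 : p.1 = A / (A + B) * κ.1 + q.1 := by simp [hp]
  have hp2 : p.2 = A / (A + B) * κ.2 + q.2 := by simp [hp]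
  have hq1 : (A + B) * q.1 = (A + B) * p.1 - A * κ.1 := by rw [hp1]; field_simp; ring
  have hq2 : (A + B) * q.2 = (A + B) * p.2 - A * κ.2 := by rw [hp2]; field_simp; ring
  rw [← hp1, ← hp2] at hV
  rw [← hp]
  have hL0 : 0 < L := by rw [hL]; positivity
  have hV0 : 0 < V := by rw [hV]; positivity
  have hL2 : L ^ 2 = (A + B) ^ 2 + κ.1 ^ 2 + κ.2 ^ 2 := by rw [hL, Real.sq_sqrt (by positivity)]
  have hV2 : V ^ 2 = A ^ 2 + p.1 ^ 2 + p.2 ^ 2 := by rw [hV, Real.sq_sqrt (by positivity)]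
  obtain ⟨W, hW⟩ : ∃ W, W = √(B ^ 2 + (κ.1 - p.1) ^ 2 + (κ.2 - p.2) ^ 2) := ⟨_, rfl⟩
  have hW0 : 0 < W := by rw [hW]; positivity
  have hW2 : W ^ 2 = B ^ 2 + (κ.1 - p.1) ^ 2 + (κ.2 - p.2) ^ 2 := by
    rw [hW, Real.sq_sqrt (by positivity)]
  rw [focalSum, ← hV, ← hW]
  obtain ⟨D, hD⟩ : ∃ D, D = A * (A + B) + p.1 * κ.1 + p.2 * κ.2 := ⟨_, rfl⟩
  obtain ⟨D', hD'⟩ : ∃ D', D' = B * (A + B) + (κ.1 - p.1) * κ.1 + (κ.2 - p.2) * κ.2 := ⟨_, rfl⟩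
  have hDD : D + D' = L ^ 2 := by rw [hD, hD', hL2]; ring
  have hW' : D' ≤ W * L := by
    refine abs_le_of_sq_le_sq' ?_ (by positivity) |>.2
    rw [mul_pow, hW2, hL2, hD']
    linarith [sq_nonneg (B * κ.1 - (A + B) * (κ.1 - p.1)),
      sq_nonneg (B * κ.2 - (A + B) * (κ.2 - p.2)),
      sq_nonneg ((κ.1 - p.1) * κ.2 - (κ.2 - p.2) * κ.1)]
  have hlag : (A + B) ^ 2 * (q.1 ^ 2 + q.2 ^ 2) ≤ (V * L) ^ 2 - D ^ 2 := by
    have : (A + B) ^ 2 * (q.1 ^ 2 + q.2 ^ 2) =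
      ((A + B) * p.1 - A * κ.1) ^ 2 + ((A + B) * p.2 - A * κ.2) ^ 2 := by rw [← hq1, ← hq2]; ring
    rw [this, mul_pow, hV2, hL2, hD]
    linarith [sq_nonneg (p.1 * κ.2 - p.2 * κ.1)]
  have hDV : D ≤ V * L := by
    refine (abs_le_of_sq_le_sq' ?_ (by positivity)).2
    have : 0 ≤ (A + B) ^ 2 * (q.1 ^ 2 + q.2 ^ 2) := by positivity
    linarith
  have key : (A + B) ^ 2 * (q.1 ^ 2 + q.2 ^ 2) ≤ 2 * (V * L) * (V * L - D) := by
    linarith [sq_nonneg (V * L - D)]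
  have h3 : V * L - D ≤ (V + W - L) * L := by linarith
  rw [div_mul_eq_mul_div, div_le_iff₀ (by positivity)]
  calc (A + B) ^ 2 * (q.1 ^ 2 + q.2 ^ 2) ≤ 2 * (V * L) * (V * L - D) := key
    _ ≤ 2 * (V * L) * ((V + W - L) * L) := by gcongr
    _ = _ := by ring

/-- The planar slices of a thickened ellipsoid at frequency `M` contain `O(M)` lattice points. -/
lemma card_focalSum_window_le {M A B τ : ℝ} (hM : 1 ≤ M) (hA : M / 2 ≤ A) (hA' : A ≤ 3 * M)
    (hB : 0 < B) (hB' : B ≤ 9 * M) (κ : ℝ × ℝ) (hκ1 : |κ.1| ≤ 6 * M) (hκ2 : |κ.2| ≤ 6 * M)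
    (P : Finset (ℤ × ℤ)) (hP1 : ∀ p ∈ P, |(p.1 : ℝ)| ≤ 2 * M) (hP2 : ∀ p ∈ P, |(p.2 : ℝ)| ≤ 2 * M)
    (hP : ∀ p ∈ P, τ ≤ focalSum A B κ (p.1, p.2) ∧ focalSum A B κ (p.1, p.2) ≤ τ + 1) :
    (P.card : ℝ) ≤ 3200000 * M := by
  have hA0 : 0 < A := by linarith
  set p₀ : ℝ × ℝ := (A / (A + B)) • κ with hp₀
  set L := √((A + B) ^ 2 + κ.1 ^ 2 + κ.2 ^ 2) with hL
  have hcen : focalSum A B κ p₀ = L := focalSum_center hA0 hB κ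
  have hr0 : 0 ≤ A / (A + B) := by positivity
  have hr1 : A / (A + B) ≤ 1 := by rw [div_le_one (by positivity)]; linarith
  have hp1 : |p₀.1| ≤ 6 * M := by
    simp only [hp₀, Prod.smul_fst, smul_eq_mul, abs_mul, abs_of_nonneg hr0]
    nlinarith [abs_nonneg κ.1]
  have hp2 : |p₀.2| ≤ 6 * M := by
    simp only [hp₀, Prod.smul_snd, smul_eq_mul, abs_mul, abs_of_nonneg hr0]
    nlinarith [abs_nonneg κ.2]
  have hL0 : 0 < L := by positivity
  have hL2 : L ^ 2 ≤ 216 * M ^ 2 := by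
    rw [hL, Real.sq_sqrt (by positivity)]
    nlinarith [sq_abs κ.1, sq_abs κ.2, abs_nonneg κ.1, abs_nonneg κ.2]
  have hvol := volume_shell_le (h := fun q => focalSum A B κ (p₀ + q) - L) (c := 1 / (40000 * M))
    (ρ := 9 * M) (w := 10) ?_ (τ - L - 5) (by positivity) (by norm_num) ?_ ?_
  · have hcard := card_le_volume_of_unit_squares P p₀ _ ?_ |>.trans hvol
    · rw [← ENNReal.ofReal_natCast, ENNReal.ofReal_le_ofReal_iff (by positivity)] at hcard
      refine hcard.trans (le_of_eq ?_)
      field_simp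
      norm_num
    · intro p hp x y hx0 hx1 hy0 hy1
      have b1 := abs_le.1 (hP1 p hp)
      have b2 := abs_le.1 (hP2 p hp)
      have b3 := abs_le.1 hp1
      have b4 := abs_le.1 hp2
      have b5 := hP p hp
      have e : p₀ + (p.1 + x - p₀.1, p.2 + y - p₀.2) = (p.1 + x, p.2 + y) := by ext <;> simp
      have l1 := focalSum_lipschitz A B κ (p.1, p.2) (p.1 + x, p.2 + y)
      have l2 := focalSum_lipschitz A B κ (p.1 + x, p.2 + y) (p.1, p.2)
      simp only [sub_add_cancel_left, add_sub_cancel_left, abs_neg, abs_of_nonneg hx0,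
        abs_of_nonneg hy0] at l1 l2
      simp only [Set.mem_ofPred_eq, e]
      refine ⟨abs_le.2 ⟨?_, ?_⟩, abs_le.2 ⟨?_, ?_⟩, ?_, ?_⟩ <;> linarith
  · simp only [focalSum]
    fun_prop
  · intro q s hs0 hs1
    have := focalSum_convex hs0 hs1 A B κ p₀ (p₀ + q)
    rw [hcen, show (1 - s) • p₀ + s • (p₀ + q) = p₀ + s • q by rw [sub_smul, one_smul, smul_add]; abel]
      at this
    linarith
  · intro q hq1 hq2
    obtain ⟨V, hV⟩ : ∃ V, V = √(A ^ 2 + (A / (A + B) * κ.1 + q.1) ^ 2 +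
      (A / (A + B) * κ.2 + q.2) ^ 2) := ⟨_, rfl⟩
    refine le_trans ?_ (focalSum_lower hA0 hB κ q hL hV)
    have hV0 : 0 < V := by rw [hV]; positivity
    have hVM : V ≤ 22 * M := by
      rw [hV]
      refine Real.sqrt_le_iff.2 ⟨by positivity, ?_⟩
      have c1 : |A / (A + B) * κ.1 + q.1| ≤ 15 * M := (abs_add_le _ _).trans (by
        have : |A / (A + B) * κ.1| ≤ 6 * M := hp1
        linarith)
      have c2 : |A / (A + B) * κ.2 + q.2| ≤ 15 * M := (abs_add_le _ _).trans (by
        have : |A / (A + B) * κ.2| ≤ 6 * M := hp2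
        linarith)
      have d1 := sq_le_sq' (by linarith [abs_nonneg (A / (A + B) * κ.1 + q.1)]) c1
      have d2 := sq_le_sq' (by linarith [abs_nonneg (A / (A + B) * κ.2 + q.2)]) c2
      rw [sq_abs] at d1 d2
      nlinarith
    gcongr ?_ * _
    rw [div_le_div_iff₀ (by positivity) (by positivity), one_mul]
    calc 2 * V * L ^ 2 ≤ 2 * (22 * M) * (216 * M ^ 2) := by gcongr
      _ ≤ (M / 2) ^ 2 * (40000 * M) := by nlinarith [pow_pos (show 0 < M by linarith) 3]
      _ ≤ (A + B) ^ 2 * (40000 * M) := by gcongr; linarith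

lemma normZ_eq (j : Fin 3) (m : Fin 3 → ℤ) :
    normZ m = √((m j : ℝ) ^ 2 + (m (j.succAbove 0) : ℝ) ^ 2 + (m (j.succAbove 1) : ℝ) ^ 2) := by
  rw [normZ, Fin.sum_univ_succAbove _ j, Fin.sum_univ_two, add_assoc]

lemma jbZ_eq (j : Fin 3) (m : Fin 3 → ℤ) :
    jbZ m = √(√(1 + (m j : ℝ) ^ 2) ^ 2 + (m (j.succAbove 0) : ℝ) ^ 2 +
      (m (j.succAbove 1) : ℝ) ^ 2) := by
  rw [jbZ, Fin.sum_univ_succAbove _ j, Fin.sum_univ_two, Real.sq_sqrt (by positivity)]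
  ring_nf

lemma abs_coord_le_normZ (m : Fin 3 → ℤ) (i : Fin 3) : |(m i : ℝ)| ≤ normZ m := by
  rw [normZ_eq i m]
  refine Real.abs_le_sqrt ?_
  linarith [sq_nonneg (m (i.succAbove 0) : ℝ), sq_nonneg (m (i.succAbove 1) : ℝ)]

lemma sqrt_one_add_sq_le {x K : ℝ} (hx : |x| ≤ K) : √(1 + x ^ 2) ≤ 1 + K := by
  have h0 := abs_nonneg x
  refine Real.sqrt_le_iff.2 ⟨by linarith, ?_⟩
  nlinarith [sq_abs x]

lemma card_int_floor_div_le {L : ℝ} (hL : 1 ≤ L) (q : ℤ) (Z : Finset ℤ)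
    (hZ : ∀ z ∈ Z, ⌊(z : ℝ) / L⌋ = q) : (Z.card : ℝ) ≤ 2 * L := by
  have hL0 : 0 < L := by linarith
  have hsub : Z ⊆ Finset.Ico ⌈q * L⌉ ⌈q * L + L⌉ := by
    intro z hz
    obtain ⟨h1, h2⟩ := Int.floor_eq_iff.1 (hZ z hz)
    rw [le_div_iff₀ hL0] at h1
    rw [div_lt_iff₀ hL0] at h2
    rw [Finset.mem_Ico]
    exact ⟨Int.ceil_le.2 h1, Int.lt_ceil.2 (by linarith)⟩
  have h1 : (Z.card : ℝ) ≤ (⌈q * L + L⌉ - ⌈q * L⌉).toNat := by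
    exact_mod_cast (Finset.card_le_card hsub).trans_eq (Int.card_Ico _ _)
  have h2 : ⌈q * L⌉ ≤ ⌈q * L + L⌉ := Int.ceil_mono (by linarith)
  have h3 : ((⌈q * L + L⌉ - ⌈q * L⌉).toNat : ℝ) = (⌈q * L + L⌉ : ℝ) - ⌈q * L⌉ := by
    have : (((⌈q * L + L⌉ - ⌈q * L⌉).toNat : ℤ) : ℝ) = ((⌈q * L + L⌉ - ⌈q * L⌉ : ℤ) : ℝ) := by
      rw [Int.toNat_of_nonneg (by linarith)]
    rwa [Int.cast_natCast, Int.cast_sub] at this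
  linarith [Int.ceil_lt_add_one (q * L + L), Int.le_ceil (q * L)]

/-- A slice `m j = z`, with `m j` the dominant coordinate. -/
lemma card_slice_le {M τ : ℝ} (hM : 1 ≤ M) (k : Fin 3 → ℤ) (hk : ∀ i, |(k i : ℝ)| ≤ 6 * M)
    (P : Finset (Fin 3 → ℤ)) (hP : ∀ m ∈ P, M ≤ normZ m ∧ normZ m ≤ 2 * M)
    (hτ : ∀ m ∈ P, τ ≤ jbZ m + jbZ (k - m) ∧ jbZ m + jbZ (k - m) ≤ τ + 1) (j : Fin 3) (z : ℤ)
    (hz : ∀ m ∈ P, m j = z) (hdom : ∀ m ∈ P, ∀ i, |(m i : ℝ)| ≤ |(m j : ℝ)|) :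
    (P.card : ℝ) ≤ 3200000 * M := by
  classical
  rcases P.eq_empty_or_nonempty with rfl | ⟨m₀, hm₀⟩
  · simp only [Finset.card_empty, Nat.cast_zero]
    positivity
  let π : (Fin 3 → ℤ) → ℤ × ℤ := fun m => (m (j.succAbove 0), m (j.succAbove 1))
  have hinj : Set.InjOn π P := by
    intro m hm m' hm' h
    have e1 := congrArg Prod.fst h
    have e2 := congrArg Prod.snd h
    funext i
    refine Fin.succAboveCases j ?_ (fun l => ?_) i
    · rw [hz m hm, hz m' hm']
    · fin_cases l
      · exact e1
      · exact e2
  rw [← Finset.card_image_of_injOn hinj]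
  have hz1 : |(z : ℝ)| ≤ 2 * M := by
    rw [← hz m₀ hm₀]
    exact (abs_coord_le_normZ m₀ j).trans (hP m₀ hm₀).2
  have hz0 : M / 2 ≤ √(1 + (z : ℝ) ^ 2) := by
    have h1 := (hP m₀ hm₀).1
    rw [normZ_eq j, Real.le_sqrt (by linarith) (by positivity)] at h1
    have h2 := sq_le_sq.2 (hdom m₀ hm₀ (j.succAbove 0))
    have h3 := sq_le_sq.2 (hdom m₀ hm₀ (j.succAbove 1))
    rw [hz m₀ hm₀] at h1 h2 h3
    exact Real.le_sqrt_of_sq_le (by nlinarith)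
  have hkz : |((k j - z : ℤ) : ℝ)| ≤ 8 * M := by
    push_cast
    exact (abs_sub _ _).trans (by linarith [hk j])
  refine card_focalSum_window_le (A := √(1 + (z : ℝ) ^ 2)) (B := √(1 + ((k j - z : ℤ) : ℝ) ^ 2))
    (τ := τ) hM hz0 ((sqrt_one_add_sq_le hz1).trans (by linarith)) (by positivity)
    ((sqrt_one_add_sq_le hkz).trans (by linarith))
    ((k (j.succAbove 0) : ℝ), (k (j.succAbove 1) : ℝ)) (hk _) (hk _) _ ?_ ?_ ?_
  · intro p hp
    obtain ⟨m, hm, rfl⟩ := Finset.mem_image.1 hp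
    exact (abs_coord_le_normZ m _).trans (hP m hm).2
  · intro p hp
    obtain ⟨m, hm, rfl⟩ := Finset.mem_image.1 hp
    exact (abs_coord_le_normZ m _).trans (hP m hm).2
  · intro p hp
    obtain ⟨m, hm, rfl⟩ := Finset.mem_image.1 hp
    have h := hτ m hm
    rw [jbZ_eq j m, jbZ_eq j (k - m)] at h
    simp only [Pi.sub_apply, hz m hm] at h
    simpa [focalSum, π] using h

/-- Lattice points of a cell of side `L` on a thickened ellipsoid at frequency `M`. -/
lemma card_cell_window_le {M L τ : ℝ} (hM : 1 ≤ M) (hL : 1 ≤ L) (k : Fin 3 → ℤ)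
    (hk : ∀ i, |(k i : ℝ)| ≤ 6 * M) (q : Fin 3 → ℤ)
    (P : Finset (Fin 3 → ℤ)) (hP : ∀ m ∈ P, M ≤ normZ m ∧ normZ m ≤ 2 * M)
    (hq : ∀ m ∈ P, ∀ i, ⌊(m i : ℝ) / L⌋ = q i)
    (hτ : ∀ m ∈ P, τ ≤ jbZ m + jbZ (k - m) ∧ jbZ m + jbZ (k - m) ≤ τ + 1) :
    (P.card : ℝ) ≤ 19200000 * (M * L) := by
  classical
  let D : Fin 3 → Finset (Fin 3 → ℤ) := fun j => P.filter fun m => ∀ i, |(m i : ℝ)| ≤ |(m j : ℝ)|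
  have hcover : P ⊆ Finset.univ.biUnion D := by
    intro m hm
    obtain ⟨j, -, hj⟩ := Finset.exists_max_image Finset.univ (fun i => |(m i : ℝ)|)
      Finset.univ_nonempty
    exact Finset.mem_biUnion.2 ⟨j, Finset.mem_univ j,
      Finset.mem_filter.2 ⟨hm, fun i => hj i (Finset.mem_univ i)⟩⟩
  have hD : ∀ j, ((D j).card : ℝ) ≤ 6400000 * (M * L) := by
    intro j
    have hfib : (D j).card = ∑ z ∈ (D j).image fun m => m j, ((D j).filter fun m => m j = z).card :=
      Finset.card_eq_sum_card_image _ _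
    have hmem : ∀ m ∈ D j, m ∈ P := fun m hm => (Finset.mem_filter.1 hm).1
    have himg : (((D j).image fun m => m j).card : ℝ) ≤ 2 * L := by
      refine card_int_floor_div_le hL (q j) _ fun z hz => ?_
      obtain ⟨m, hm, rfl⟩ := Finset.mem_image.1 hz
      exact hq m (hmem m hm) j
    rw [hfib, Nat.cast_sum]
    calc ∑ z ∈ (D j).image fun m => m j, (((D j).filter fun m => m j = z).card : ℝ)
        ≤ ∑ _z ∈ (D j).image fun m => m j, 3200000 * M := by
          refine Finset.sum_le_sum fun z _ => card_slice_le (τ := τ) hM k hk _ ?_ ?_ j z ?_ ?_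
          · exact fun m hm => hP m (hmem m (Finset.mem_filter.1 hm).1)
          · exact fun m hm => hτ m (hmem m (Finset.mem_filter.1 hm).1)
          · exact fun m hm => (Finset.mem_filter.1 hm).2
          · exact fun m hm => (Finset.mem_filter.1 (Finset.mem_filter.1 hm).1).2
      _ = ((D j).image fun m => m j).card * (3200000 * M) := by simp
      _ ≤ 2 * L * (3200000 * M) := by gcongr
      _ = 6400000 * (M * L) := by ring
  calc (P.card : ℝ) ≤ ∑ j, ((D j).card : ℝ) := by
        exact_mod_cast (Finset.card_le_card hcover).trans Finset.card_biUnion_le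
    _ ≤ ∑ _j : Fin 3, 6400000 * (M * L) := Finset.sum_le_sum fun j _ => hD j
    _ = 19200000 * (M * L) := by simp; ring

open scoped ComplexConjugate in
lemma norm_sum_sq_eq {ι : Type*} (J : Finset ι) (z : ι → ℂ) :
    ((‖∑ j ∈ J, z j‖ ^ 2 : ℝ) : ℂ) = ∑ i ∈ J, ∑ j ∈ J, z i * conj (z j) := by
  rw [Complex.ofReal_pow, ← Complex.mul_conj', map_sum, Finset.sum_mul_sum]

lemma sum_mul_mul_le_of_row_sum_le {ι : Type*} (J : Finset ι) (x : ι → ℝ) (w : ι → ι → ℝ)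
    (hw : ∀ i j, 0 ≤ w i j) (hsymm : ∀ i j, w i j = w j i) {S : ℝ}
    (hS : ∀ i ∈ J, ∑ j ∈ J, w i j ≤ S) :
    ∑ i ∈ J, ∑ j ∈ J, x i * x j * w i j ≤ S * ∑ i ∈ J, x i ^ 2 := by
  have h1 : ∑ i ∈ J, ∑ j ∈ J, x i * x j * w i j ≤
      ∑ i ∈ J, ∑ j ∈ J, (x i ^ 2 * w i j / 2 + x j ^ 2 * w j i / 2) := by
    refine Finset.sum_le_sum fun i _ => Finset.sum_le_sum fun j _ => ?_
    rw [hsymm j i]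
    nlinarith [mul_nonneg (sq_nonneg (x i - x j)) (hw i j)]
  refine h1.trans ?_
  simp only [Finset.sum_add_distrib]
  rw [Finset.sum_comm (f := fun i j => x j ^ 2 * w j i / 2), ← Finset.sum_add_distrib,
    Finset.mul_sum]
  refine Finset.sum_le_sum fun i hi => ?_
  rw [← Finset.sum_add_distrib]
  calc ∑ j ∈ J, (x i ^ 2 * w i j / 2 + x i ^ 2 * w i j / 2) = x i ^ 2 * ∑ j ∈ J, w i j := by
        rw [Finset.mul_sum]; exact Finset.sum_congr rfl fun j _ => by ring
    _ ≤ x i ^ 2 * S := by gcongr; exact hS i hi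
    _ = S * x i ^ 2 := mul_comm _ _

lemma summable_int_window_weight : Summable fun l : ℤ => 8 / (1 + (l : ℝ) ^ 2) := by
  have h1 : Summable fun l : ℤ => 8 * (1 / (l : ℝ) ^ 2) :=
    (Real.summable_one_div_int_pow.2 (by norm_num)).mul_left 8
  have h2 : Summable fun l : ℤ => if l = 0 then (8 : ℝ) else 0 :=
    summable_of_ne_finset_zero (s := {0}) fun l hl => by simp_all
  refine Summable.of_nonneg_of_le (fun l => by positivity) (fun l => ?_) (h1.add h2)
  by_cases hl : l = 0
  · simp [hl]
  · have : (0 : ℝ) < (l : ℝ) ^ 2 := by positivity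
    rw [if_neg hl, add_zero, mul_one_div]
    gcongr
    linarith

lemma exp_neg_sq_le_window_weight (x : ℝ) :
    Real.exp (-x ^ 2 / 4) ≤ 8 / (1 + (⌊x⌋ : ℝ) ^ 2) := by
  have h1 : x ^ 2 / 4 + 1 ≤ Real.exp (x ^ 2 / 4) := Real.add_one_le_exp _
  rw [neg_div, Real.exp_neg, inv_eq_one_div, div_le_div_iff₀ (Real.exp_pos _) (by positivity)]
  have h2 := Int.floor_le x
  have h3 := Int.lt_floor_add_one x
  nlinarith [sq_nonneg (x + (x - ⌊x⌋))]

/-- If every unit window contains at most `K` of the `μ j`, Gaussian row sums are `O(K)`. -/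
lemma sum_gaussian_le {ι : Type*} (J : Finset ι) (μ : ι → ℝ) {K : ℝ}
    (hK : ∀ τ : ℝ, ((J.filter fun j => τ ≤ μ j ∧ μ j ≤ τ + 1).card : ℝ) ≤ K) (s : ℝ) :
    ∑ j ∈ J, Real.exp (-(s - μ j) ^ 2 / 4) ≤ K * ∑' l : ℤ, 8 / (1 + (l : ℝ) ^ 2) := by
  classical
  have hK0 : 0 ≤ K := (Nat.cast_nonneg _).trans (hK 0)
  let fl : ι → ℤ := fun j => ⌊μ j - s⌋
  rw [← Finset.sum_fiberwise_of_maps_to (g := fl) (t := J.image fl)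
    fun j hj => Finset.mem_image_of_mem fl hj]
  calc ∑ l ∈ J.image fl, ∑ j ∈ J with fl j = l, Real.exp (-(s - μ j) ^ 2 / 4)
      ≤ ∑ l ∈ J.image fl, K * (8 / (1 + (l : ℝ) ^ 2)) := by
        refine Finset.sum_le_sum fun l _ => ?_
        have hcard : ((J.filter fun j => fl j = l).card : ℝ) ≤ K := by
          refine le_trans ?_ (hK (s + l))
          gcongr with j _
          rintro rfl
          have h2 := Int.floor_le (μ j - s)
          have h3 := Int.lt_floor_add_one (μ j - s)
          exact ⟨by linarith, by linarith⟩
        calc ∑ j ∈ J with fl j = l, Real.exp (-(s - μ j) ^ 2 / 4)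
            ≤ ∑ j ∈ J with fl j = l, 8 / (1 + (l : ℝ) ^ 2) := by
              refine Finset.sum_le_sum fun j hj => ?_
              rw [← (Finset.mem_filter.1 hj).2, sub_sq_comm]
              exact exp_neg_sq_le_window_weight _
          _ = (J.filter fun j => fl j = l).card * (8 / (1 + (l : ℝ) ^ 2)) := by simp
          _ ≤ _ := by gcongr
    _ = K * ∑ l ∈ J.image fl, 8 / (1 + (l : ℝ) ^ 2) := by rw [Finset.mul_sum]
    _ ≤ _ := by
        gcongr
        exact summable_int_window_weight.sum_le_tsum _ fun l _ => by positivity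

lemma integral_exp_mul_gaussian (s : ℝ) :
    ∫ t : ℝ, Complex.exp (Complex.I * ((t * s : ℝ) : ℂ)) * ((Real.exp (-t ^ 2) : ℝ) : ℂ) =
      ((√Real.pi * Real.exp (-s ^ 2 / 4) : ℝ) : ℂ) := by
  have h := fourierIntegral_gaussian (b := 1) (by simp) (s : ℂ)
  have e : ∀ t : ℝ, Complex.exp (Complex.I * ((t * s : ℝ) : ℂ)) * ((Real.exp (-t ^ 2) : ℝ) : ℂ) =
      Complex.exp (Complex.I * s * t) * Complex.exp (-1 * (t : ℂ) ^ 2) := fun t => by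
    push_cast
    ring_nf
  simp_rw [e, h]
  push_cast
  rw [Real.sqrt_eq_rpow, Complex.ofReal_cpow Real.pi_pos.le]
  simp

lemma integrable_exp_mul_gaussian (s : ℝ) : Integrable fun t : ℝ =>
    Complex.exp (Complex.I * ((t * s : ℝ) : ℂ)) * ((Real.exp (-t ^ 2) : ℝ) : ℂ) := by
  have hg : Integrable fun t : ℝ => ((Real.exp (-t ^ 2) : ℝ) : ℂ) := by
    simpa using (integrable_exp_neg_mul_sq one_pos).ofReal (𝕜 := ℂ)
  refine hg.bdd_mul (c := 1) (by fun_prop) (Filter.Eventually.of_forall fun t => ?_)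
  rw [mul_comm, Complex.norm_exp_ofReal_mul_I]

/-- Large-sieve bound for exponential sums in time. -/
lemma lintegral_exp_sum_le {ι : Type*} (J : Finset ι) (c : ι → ℂ) (μ : ι → ℝ) {K : ℝ}
    (hK : ∀ τ : ℝ, ((J.filter fun j => τ ≤ μ j ∧ μ j ≤ τ + 1).card : ℝ) ≤ K) (T : ℝ) :
    ∫⁻ t in Set.Icc 0 T, ENNReal.ofReal
        (‖∑ j ∈ J, c j * Complex.exp (Complex.I * ((t * μ j : ℝ) : ℂ))‖ ^ 2) ≤
      ENNReal.ofReal (Real.exp (T ^ 2) * (√Real.pi * (K * ∑' l : ℤ, 8 / (1 + (l : ℝ) ^ 2))) *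
        ∑ j ∈ J, ‖c j‖ ^ 2) := by
  set F : ℝ → ℂ := fun t => ∑ j ∈ J, c j * Complex.exp (Complex.I * ((t * μ j : ℝ) : ℂ)) with hF
  set S := ∑' l : ℤ, 8 / (1 + (l : ℝ) ^ 2) with hS
  have hexpand : ∀ t, ((‖F t‖ ^ 2 * Real.exp (-t ^ 2) : ℝ) : ℂ) =
      ∑ i ∈ J, ∑ j ∈ J, (c i * (starRingEnd ℂ) (c j)) *
        (Complex.exp (Complex.I * ((t * (μ i - μ j) : ℝ) : ℂ)) *
          ((Real.exp (-t ^ 2) : ℝ) : ℂ)) := by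
    intro t
    rw [Complex.ofReal_mul, hF, norm_sum_sq_eq, Finset.sum_mul]
    refine Finset.sum_congr rfl fun i _ => ?_
    rw [Finset.sum_mul]
    refine Finset.sum_congr rfl fun j _ => ?_
    rw [map_mul, ← Complex.exp_conj, map_mul, Complex.conj_I, Complex.conj_ofReal,
      show (t * (μ i - μ j) : ℝ) = t * μ i - t * μ j by ring, Complex.ofReal_sub, mul_sub,
      sub_eq_add_neg, ← neg_mul, Complex.exp_add]
    ring
  have hint : Integrable fun t => ((‖F t‖ ^ 2 * Real.exp (-t ^ 2) : ℝ) : ℂ) := by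
    simp_rw [hexpand]
    exact integrable_finsetSum _ fun i _ => integrable_finsetSum _ fun j _ =>
      (integrable_exp_mul_gaussian _).const_mul _
  have hintR : Integrable fun t => ‖F t‖ ^ 2 * Real.exp (-t ^ 2) := by
    exact hint.re
  have hval : ((∫ t, ‖F t‖ ^ 2 * Real.exp (-t ^ 2) : ℝ) : ℂ) =
      ∑ i ∈ J, ∑ j ∈ J, (c i * (starRingEnd ℂ) (c j)) *
        ((√Real.pi * Real.exp (-(μ i - μ j) ^ 2 / 4) : ℝ) : ℂ) := by
    rw [← integral_complex_ofReal]
    simp_rw [hexpand]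
    rw [integral_finsetSum _ fun i _ => integrable_finsetSum _ fun j _ =>
      (integrable_exp_mul_gaussian _).const_mul _]
    refine Finset.sum_congr rfl fun i _ => ?_
    rw [integral_finsetSum _ fun j _ => (integrable_exp_mul_gaussian _).const_mul _]
    refine Finset.sum_congr rfl fun j _ => ?_
    rw [integral_const_mul, integral_exp_mul_gaussian]
  have hbound : ∫ t, ‖F t‖ ^ 2 * Real.exp (-t ^ 2) ≤ √Real.pi * (K * S) * ∑ j ∈ J, ‖c j‖ ^ 2 := by
    calc ∫ t, ‖F t‖ ^ 2 * Real.exp (-t ^ 2)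
        ≤ ‖((∫ t, ‖F t‖ ^ 2 * Real.exp (-t ^ 2) : ℝ) : ℂ)‖ := by
          rw [Complex.norm_real]; exact le_abs_self _
      _ ≤ ∑ i ∈ J, ∑ j ∈ J, ‖c i‖ * ‖c j‖ * (√Real.pi * Real.exp (-(μ i - μ j) ^ 2 / 4)) := by
          rw [hval]
          refine (norm_sum_le _ _).trans (Finset.sum_le_sum fun i _ =>
            (norm_sum_le _ _).trans (Finset.sum_le_sum fun j _ => le_of_eq ?_))
          rw [norm_mul, norm_mul, RCLike.norm_conj, Complex.norm_real, Real.norm_eq_abs,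
            abs_of_nonneg (by positivity)]
      _ ≤ _ := by
          refine sum_mul_mul_le_of_row_sum_le J _ _ (fun i j => by positivity)
            (fun i j => by rw [sub_sq_comm]) fun i _ => ?_
          rw [← Finset.mul_sum]
          gcongr
          exact sum_gaussian_le J μ hK (μ i)
  calc ∫⁻ t in Set.Icc 0 T, ENNReal.ofReal (‖F t‖ ^ 2)
      ≤ ∫⁻ t in Set.Icc 0 T,
          ENNReal.ofReal (Real.exp (T ^ 2) * (‖F t‖ ^ 2 * Real.exp (-t ^ 2))) := by
        refine setLIntegral_mono' measurableSet_Icc fun t ht => ENNReal.ofReal_le_ofReal ?_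
        have h1 : 1 ≤ Real.exp (T ^ 2) * Real.exp (-t ^ 2) := by
          rw [← Real.exp_add]
          refine Real.one_le_exp ?_
          nlinarith [ht.1, ht.2]
        calc ‖F t‖ ^ 2 = ‖F t‖ ^ 2 * 1 := (mul_one _).symm
          _ ≤ ‖F t‖ ^ 2 * (Real.exp (T ^ 2) * Real.exp (-t ^ 2)) := by gcongr
          _ = _ := by ring
    _ ≤ ∫⁻ t, ENNReal.ofReal (Real.exp (T ^ 2) * (‖F t‖ ^ 2 * Real.exp (-t ^ 2))) :=
        setLIntegral_le_lintegral _ _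
    _ = ENNReal.ofReal (∫ t, Real.exp (T ^ 2) * (‖F t‖ ^ 2 * Real.exp (-t ^ 2))) :=
        (ofReal_integral_eq_lintegral_ofReal (hintR.const_mul _)
          (Filter.Eventually.of_forall fun t => by positivity)).symm
    _ ≤ _ := by
        rw [integral_const_mul, mul_assoc]
        gcongr

lemma integral_circle_exp (n : ℤ) :
    ∫ x in Set.Ico (0 : ℝ) (2 * Real.pi), Complex.exp (Complex.I * ((n * x : ℝ) : ℂ)) =
      if n = 0 then ((2 * Real.pi : ℝ) : ℂ) else 0 := by
  rw [integral_Ico_eq_integral_Ioc, ← intervalIntegral.integral_of_le Real.two_pi_pos.le]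
  split_ifs with h
  · simp [h]
  · have hn : Complex.I * (n : ℂ) ≠ 0 := mul_ne_zero Complex.I_ne_zero (Int.cast_ne_zero.2 h)
    have e : ∀ x : ℝ, Complex.I * ((n * x : ℝ) : ℂ) = Complex.I * n * x := fun x => by
      push_cast; ring
    simp_rw [e]
    rw [integral_exp_mul_complex hn]
    have : Complex.exp (Complex.I * n * ((2 * Real.pi : ℝ) : ℂ)) = 1 := by
      rw [← Complex.exp_int_mul_two_pi_mul_I n]
      push_cast; ring_nf
    rw [this, Complex.ofReal_zero, mul_zero, Complex.exp_zero, sub_self, zero_div]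

lemma volume_restrict_cube :
    (volume.restrict cube : Measure (Fin 3 → ℝ)) =
      Measure.pi fun _ => volume.restrict (Set.Ico (0 : ℝ) (2 * Real.pi)) := by
  rw [cube, volume_pi, Measure.restrict_pi_pi]

instance isFiniteMeasure_restrict_cube :
    IsFiniteMeasure (volume.restrict cube : Measure (Fin 3 → ℝ)) := by
  rw [volume_restrict_cube]
  infer_instance

lemma integral_cube_exp (k : Fin 3 → ℤ) :
    ∫ x in cube, Complex.exp (Complex.I * ((dotZ k x : ℝ) : ℂ)) =
      if k = 0 then (((2 * Real.pi) ^ 3 : ℝ) : ℂ) else 0 := by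
  have e : ∀ x : Fin 3 → ℝ, Complex.exp (Complex.I * ((dotZ k x : ℝ) : ℂ)) =
      ∏ i, Complex.exp (Complex.I * ((k i * x i : ℝ) : ℂ)) := fun x => by
    rw [← Complex.exp_sum, dotZ, Complex.ofReal_sum, Finset.mul_sum]
  simp_rw [e]
  rw [volume_restrict_cube, integral_fintype_prod_eq_prod
    (f := fun i (y : ℝ) => Complex.exp (Complex.I * ((k i * y : ℝ) : ℂ)))]
  simp_rw [integral_circle_exp]
  split_ifs with h
  · simp [h]
  · obtain ⟨i, hi⟩ := Function.ne_iff.1 h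
    exact Finset.prod_eq_zero (Finset.mem_univ i) (if_neg hi)

lemma continuous_dotZ (k : Fin 3 → ℤ) : Continuous (dotZ k) := by
  unfold dotZ
  fun_prop

lemma lintegral_cube_trigPoly (S : Finset (Fin 3 → ℤ)) (c : (Fin 3 → ℤ) → ℂ) :
    ∫⁻ x in cube, ENNReal.ofReal
        (‖∑ k ∈ S, c k * Complex.exp (Complex.I * ((dotZ k x : ℝ) : ℂ))‖ ^ 2) =
      ENNReal.ofReal ((2 * Real.pi) ^ 3 * ∑ k ∈ S, ‖c k‖ ^ 2) := by
  classical
  set F : (Fin 3 → ℝ) → ℂ :=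
    fun x => ∑ k ∈ S, c k * Complex.exp (Complex.I * ((dotZ k x : ℝ) : ℂ)) with hF
  have hI : ∀ k : Fin 3 → ℤ, Integrable (fun x =>
      Complex.exp (Complex.I * ((dotZ k x : ℝ) : ℂ))) (volume.restrict cube) := fun k => by
    have hc := continuous_dotZ k
    refine Integrable.of_bound (by fun_prop) 1 (Filter.Eventually.of_forall fun x => ?_)
    rw [mul_comm, Complex.norm_exp_ofReal_mul_I]
  have hexpand : ∀ x, ((‖F x‖ ^ 2 : ℝ) : ℂ) = ∑ k ∈ S, ∑ l ∈ S, (c k * (starRingEnd ℂ) (c l)) *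
      Complex.exp (Complex.I * ((dotZ (k - l) x : ℝ) : ℂ)) := by
    intro x
    rw [hF, norm_sum_sq_eq]
    refine Finset.sum_congr rfl fun k _ => Finset.sum_congr rfl fun l _ => ?_
    have : dotZ (k - l) x = dotZ k x - dotZ l x := by simp [dotZ, sub_mul]
    rw [map_mul, ← Complex.exp_conj, map_mul, Complex.conj_I, Complex.conj_ofReal, this,
      Complex.ofReal_sub, mul_sub, sub_eq_add_neg, ← neg_mul, Complex.exp_add]
    ring
  have hint : Integrable (fun x => ((‖F x‖ ^ 2 : ℝ) : ℂ)) (volume.restrict cube) := by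
    simp_rw [hexpand]
    exact integrable_finsetSum _ fun i _ => integrable_finsetSum _ fun j _ =>
      (hI _).const_mul _
  have hval : ((∫ x in cube, ‖F x‖ ^ 2 : ℝ) : ℂ) =
      (((2 * Real.pi) ^ 3 * ∑ k ∈ S, ‖c k‖ ^ 2 : ℝ) : ℂ) := by
    rw [← integral_complex_ofReal]
    simp_rw [hexpand]
    rw [integral_finsetSum _ fun i _ => integrable_finsetSum _ fun j _ => (hI _).const_mul _,
      Finset.mul_sum, Complex.ofReal_sum]
    refine Finset.sum_congr rfl fun k hk => ?_
    rw [integral_finsetSum _ fun j _ => (hI _).const_mul _]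
    simp_rw [integral_const_mul, integral_cube_exp, sub_eq_zero]
    simp only [mul_ite, mul_zero, Finset.sum_ite_eq, hk, if_true]
    rw [Complex.mul_conj']
    push_cast
    ring
  have hintR : Integrable (fun x => ‖F x‖ ^ 2) (volume.restrict cube) := hint.re
  rw [← ofReal_integral_eq_lintegral_ofReal hintR
    (Filter.Eventually.of_forall fun x => by positivity), Complex.ofReal_injective hval]

lemma sum_norm_sq_fiber_sum {ι G : Type*} [DecidableEq G] (P : Finset ι) (φ : ι → G) (F : ι → ℂ) :
    ((∑ k ∈ P.image φ, ‖∑ p ∈ P with φ p = k, F p‖ ^ 2 : ℝ) : ℂ) =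
      ∑ p ∈ P, ∑ p' ∈ P, if φ p = φ p' then F p * (starRingEnd ℂ) (F p') else 0 := by
  rw [Complex.ofReal_sum, ← Finset.sum_fiberwise_of_maps_to (g := φ) (t := P.image φ)
    (fun p hp => Finset.mem_image_of_mem φ hp)
    (fun p => ∑ p' ∈ P, if φ p = φ p' then F p * (starRingEnd ℂ) (F p') else 0)]
  refine Finset.sum_congr rfl fun k _ => ?_
  rw [norm_sum_sq_eq]
  refine Finset.sum_congr rfl fun p hp => ?_
  rw [Finset.sum_filter]
  refine Finset.sum_congr rfl fun p' _ => ?_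
  rw [(Finset.mem_filter.1 hp).2]
  exact if_congr eq_comm rfl rfl

/-- Replacing `v` by its complex conjugate does not change the `L²` norm of a product `uv`. -/
lemma sum_norm_sq_add_eq_sub {G : Type*} [AddCommGroup G] [DecidableEq G] (A B : Finset G)
    (f g : G → ℂ) :
    ∑ k ∈ (A ×ˢ B).image (fun p => p.1 + p.2),
        ‖∑ p ∈ A ×ˢ B with p.1 + p.2 = k, f p.1 * g p.2‖ ^ 2 =
      ∑ k ∈ (A ×ˢ B).image (fun p => p.1 - p.2),
        ‖∑ p ∈ A ×ˢ B with p.1 - p.2 = k, f p.1 * (starRingEnd ℂ) (g p.2)‖ ^ 2 := by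
  refine Complex.ofReal_injective ?_
  rw [sum_norm_sq_fiber_sum (A ×ˢ B) (fun p => p.1 + p.2) (fun p => f p.1 * g p.2),
    sum_norm_sq_fiber_sum (A ×ˢ B) (fun p => p.1 - p.2)
      (fun p => f p.1 * (starRingEnd ℂ) (g p.2))]
  simp only [Finset.sum_product]
  refine Finset.sum_congr rfl fun m _ => ?_
  rw [Finset.sum_comm]
  conv_rhs => rw [Finset.sum_comm]
  refine Finset.sum_congr rfl fun m' _ => ?_
  rw [Finset.sum_comm]
  refine Finset.sum_congr rfl fun n' _ => Finset.sum_congr rfl fun n _ => ?_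
  refine if_congr ?_ ?_ rfl
  · rw [sub_eq_sub_iff_add_eq_add]
  · simp only [map_mul, Complex.conj_conj]
    ring

/-- The constant in the large-sieve bound on `[0, T]`. -/
noncomputable def sieveConst (T : ℝ) : ℝ :=
  Real.exp (T ^ 2) * (√Real.pi * ∑' l : ℤ, 8 / (1 + (l : ℝ) ^ 2))

lemma sieveConst_nonneg (T : ℝ) : 0 ≤ sieveConst T :=
  mul_nonneg (Real.exp_pos _).le (mul_nonneg (Real.sqrt_nonneg _)
    (tsum_nonneg fun l => by positivity))

lemma lintegral_fiber_exp_sum_le {ι G : Type*} [DecidableEq G] (P : Finset ι) (φ : ι → G)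
    (c : ι → ℂ) (μ : ι → ℝ) {K : ℝ}
    (hK : ∀ (k : G) (τ : ℝ),
      ((P.filter fun p => φ p = k ∧ τ ≤ μ p ∧ μ p ≤ τ + 1).card : ℝ) ≤ K) (T : ℝ) :
    ∫⁻ t in Set.Icc 0 T, ENNReal.ofReal (∑ k ∈ P.image φ,
        ‖∑ p ∈ P with φ p = k, c p * Complex.exp (Complex.I * ((t * μ p : ℝ) : ℂ))‖ ^ 2) ≤
      ENNReal.ofReal (sieveConst T * K * ∑ p ∈ P, ‖c p‖ ^ 2) := by
  simp_rw [ENNReal.ofReal_sum_of_nonneg fun (k : G) _ => sq_nonneg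
    ‖∑ p ∈ P with φ p = k, c p * Complex.exp (Complex.I * ((_ : ℝ) : ℂ))‖]
  rw [lintegral_finsetSum _ fun k _ => by fun_prop]
  have hK0 : ∀ k : G, 0 ≤ K := fun k => (Nat.cast_nonneg _).trans (hK k 0)
  calc _ ≤ ∑ k ∈ P.image φ, ENNReal.ofReal (sieveConst T * K * ∑ p ∈ P with φ p = k, ‖c p‖ ^ 2) := by
        refine Finset.sum_le_sum fun k _ => ?_
        refine (lintegral_exp_sum_le _ c μ (K := K) (fun τ => ?_) T).trans_eq ?_
        · rw [Finset.filter_filter]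
          exact hK k τ
        · rw [sieveConst]
          ring_nf
    _ = ENNReal.ofReal (∑ k ∈ P.image φ, sieveConst T * K * ∑ p ∈ P with φ p = k, ‖c p‖ ^ 2) :=
        (ENNReal.ofReal_sum_of_nonneg fun k _ => mul_nonneg
          (mul_nonneg (sieveConst_nonneg T) (hK0 k)) (by positivity)).symm
    _ = _ := by
        rw [← Finset.mul_sum, Finset.sum_fiberwise_of_maps_to
          fun p hp => Finset.mem_image_of_mem φ hp]

/-- The product of two free waves with frequencies in `A` and `B`, projected to `S`. -/
noncomputable def projProd (S A B : Finset (Fin 3 → ℤ)) (σ₁ σ₂ : ℝ) (a b : (Fin 3 → ℤ) → ℂ)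
    (t : ℝ) (x : Fin 3 → ℝ) : ℂ :=
  ∑ k ∈ S, (∑ m ∈ A, ∑ n ∈ B, if m + n = k then
      a m * b n * Complex.exp (Complex.I * ((t * (σ₁ * jbZ m + σ₂ * jbZ n) : ℝ) : ℂ)) else 0) *
    Complex.exp (Complex.I * ((dotZ k x : ℝ) : ℂ))

lemma projProdWave_eq_projProd (O M N σ₁ σ₂ : ℝ) (a b : (Fin 3 → ℤ) → ℂ) :
    projProdWave O M N σ₁ σ₂ a b = projProd (annulus O) (annulus M) (annulus N) σ₁ σ₂ a b := rfl

lemma continuous_projProd (S A B : Finset (Fin 3 → ℤ)) (σ₁ σ₂ : ℝ) (a b : (Fin 3 → ℤ) → ℂ) :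
    Continuous fun p : ℝ × (Fin 3 → ℝ) => projProd S A B σ₁ σ₂ a b p.1 p.2 := by
  have hd := continuous_dotZ
  unfold projProd
  refine continuous_finsetSum _ fun k _ => Continuous.mul (continuous_finsetSum _ fun m _ =>
    continuous_finsetSum _ fun n _ => ?_) (by fun_prop)
  split_ifs <;> fun_prop

lemma lintegral_projProd_le (S A B : Finset (Fin 3 → ℤ)) (σ₁ σ₂ : ℝ) (a b : (Fin 3 → ℤ) → ℂ)
    (T : ℝ) :
    ∫⁻ p in Set.Icc 0 T ×ˢ cube, ENNReal.ofReal (‖projProd S A B σ₁ σ₂ a b p.1 p.2‖ ^ 2) ≤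
      ENNReal.ofReal ((2 * Real.pi) ^ 3) * ∫⁻ t in Set.Icc 0 T, ENNReal.ofReal
        (∑ k ∈ (A ×ˢ B).image (fun p => p.1 + p.2), ‖∑ p ∈ A ×ˢ B with p.1 + p.2 = k,
          a p.1 * b p.2 *
            Complex.exp (Complex.I * ((t * (σ₁ * jbZ p.1 + σ₂ * jbZ p.2) : ℝ) : ℂ))‖ ^ 2) := by
  have hc := continuous_projProd S A B σ₁ σ₂ a b
  rw [Measure.volume_eq_prod, ← Measure.prod_restrict, lintegral_prod _ (by fun_prop),
    ← lintegral_const_mul' _ _ ENNReal.ofReal_ne_top]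
  refine lintegral_mono fun t => ?_
  simp only [projProd]
  rw [lintegral_cube_trigPoly, ← ENNReal.ofReal_mul (by positivity)]
  refine ENNReal.ofReal_le_ofReal ?_
  gcongr
  have hfib : ∀ k, (∑ m ∈ A, ∑ n ∈ B, if m + n = k then
      a m * b n * Complex.exp (Complex.I * ((t * (σ₁ * jbZ m + σ₂ * jbZ n) : ℝ) : ℂ)) else 0) =
      ∑ p ∈ A ×ˢ B with p.1 + p.2 = k, a p.1 * b p.2 *
        Complex.exp (Complex.I * ((t * (σ₁ * jbZ p.1 + σ₂ * jbZ p.2) : ℝ) : ℂ)) := fun k => by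
    rw [Finset.sum_filter, Finset.sum_product]
  simp_rw [hfib]
  refine (Finset.sum_le_sum_of_subset_of_nonneg (Finset.subset_union_left (s₂ :=
    (A ×ˢ B).image fun p => p.1 + p.2)) fun k _ _ => by positivity).trans_eq ?_
  refine (Finset.sum_subset Finset.subset_union_right fun k _ hk => ?_).symm
  rw [Finset.filter_eq_empty_iff.2, Finset.sum_empty, norm_zero, zero_pow two_ne_zero]
  exact fun p hp hpk => hk (Finset.mem_image.2 ⟨p, hp, hpk⟩)

lemma mem_annulus_bounds {N : ℝ} {n : Fin 3 → ℤ} (hn : n ∈ annulus N) :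
    N ≤ normZ n ∧ normZ n < 2 * N := by
  classical
  exact (Finset.mem_filter.1 hn).2

lemma normZ_add_le (m n : Fin 3 → ℤ) : normZ (m + n) ≤ normZ m + normZ n := by
  rw [normZ_eq 0, normZ_eq 0 m, normZ_eq 0 n]
  simpa using sqrt_sum_sq_add_le (m 0) (m 1) (m 2) (n 0) (n 1) (n 2)

lemma jbZ_sub_comm (m n : Fin 3 → ℤ) : jbZ (m - n) = jbZ (n - m) := by
  simp only [jbZ, Pi.sub_apply, Int.cast_sub]
  congr 2
  exact Finset.sum_congr rfl fun i _ => sub_sq_comm _ _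

lemma card_pairs_window_le {M L : ℝ} (hM : 1 ≤ M) (hL : 1 ≤ L) (q k : Fin 3 → ℤ) {σ : ℝ}
    (hσ : σ = 1 ∨ σ = -1) (τ : ℝ) (P : Finset ((Fin 3 → ℤ) × (Fin 3 → ℤ)))
    (hP : ∀ p ∈ P, M ≤ normZ p.1 ∧ normZ p.1 ≤ 2 * M)
    (hq : ∀ p ∈ P, ∀ i, ⌊(p.1 i : ℝ) / L⌋ = q i)
    (hk : ∀ p ∈ P, ∀ i, |(k i : ℝ)| ≤ 6 * M)
    (hinj : Set.InjOn Prod.fst (P : Set ((Fin 3 → ℤ) × (Fin 3 → ℤ))))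
    (hjb : ∀ p ∈ P, jbZ p.2 = jbZ (k - p.1))
    (hτ : ∀ p ∈ P, τ ≤ σ * jbZ p.1 + σ * jbZ p.2 ∧ σ * jbZ p.1 + σ * jbZ p.2 ≤ τ + 1) :
    (P.card : ℝ) ≤ 19200000 * (M * L) := by
  rcases P.eq_empty_or_nonempty with rfl | ⟨p₀, hp₀⟩
  · simp only [Finset.card_empty, Nat.cast_zero]
    positivity
  rw [← Finset.card_image_of_injOn hinj]
  have hmem : ∀ m ∈ P.image Prod.fst, ∃ p ∈ P, p.1 = m := fun m hm => Finset.mem_image.1 hm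
  rcases hσ with rfl | rfl
  · refine card_cell_window_le (τ := τ) hM hL k (hk p₀ hp₀) q _ ?_ ?_ ?_
    all_goals
      intro m hm
      obtain ⟨p, hp, rfl⟩ := hmem m hm
    · exact hP p hp
    · exact hq p hp
    · have := hτ p hp
      rw [hjb p hp] at this
      constructor <;> linarith
  · refine card_cell_window_le (τ := -τ - 1) hM hL k (hk p₀ hp₀) q _ ?_ ?_ ?_
    all_goals
      intro m hm
      obtain ⟨p, hp, rfl⟩ := hmem m hm
    · exact hP p hp
    · exact hq p hp
    · have := hτ p hp
      rw [hjb p hp] at this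
      constructor <;> linarith

/-- The bilinear estimate when the frequencies of `u` lie in one cell of side `L`. -/
lemma lintegral_projProd_cell_le {M L : ℝ} (hM : 1 ≤ M) (hL : 1 ≤ L) (q : Fin 3 → ℤ)
    (S A B : Finset (Fin 3 → ℤ)) (hA : ∀ m ∈ A, M ≤ normZ m ∧ normZ m ≤ 2 * M)
    (hq : ∀ m ∈ A, ∀ i, ⌊(m i : ℝ) / L⌋ = q i) (hB : ∀ n ∈ B, normZ n ≤ 4 * M) {σ₁ σ₂ : ℝ}
    (hσ₁ : σ₁ = 1 ∨ σ₁ = -1) (hσ₂ : σ₂ = 1 ∨ σ₂ = -1) (a b : (Fin 3 → ℤ) → ℂ) (T : ℝ) :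
    ∫⁻ p in Set.Icc 0 T ×ˢ cube, ENNReal.ofReal (‖projProd S A B σ₁ σ₂ a b p.1 p.2‖ ^ 2) ≤
      ENNReal.ofReal ((2 * Real.pi) ^ 3 * (sieveConst T * (19200000 * (M * L)) *
        ((∑ m ∈ A, ‖a m‖ ^ 2) * ∑ n ∈ B, ‖b n‖ ^ 2))) := by
  refine (lintegral_projProd_le S A B σ₁ σ₂ a b T).trans ?_
  rw [ENNReal.ofReal_mul (by positivity)]
  gcongr
  have hcoord : ∀ p ∈ A ×ˢ B, ∀ i, |(p.1 i : ℝ)| ≤ 2 * M ∧ |(p.2 i : ℝ)| ≤ 4 * M := fun p hp i => by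
    rw [Finset.mem_product] at hp
    exact ⟨(abs_coord_le_normZ _ i).trans (hA _ hp.1).2, (abs_coord_le_normZ _ i).trans (hB _ hp.2)⟩
  have hAP : ∀ p ∈ A ×ˢ B, p.1 ∈ A := fun p hp => (Finset.mem_product.1 hp).1
  by_cases hσ : σ₂ = σ₁
  · subst hσ
    refine (lintegral_fiber_exp_sum_le (A ×ˢ B) (fun p => p.1 + p.2) (fun p => a p.1 * b p.2)
      (fun p => σ₂ * jbZ p.1 + σ₂ * jbZ p.2) (K := 19200000 * (M * L)) (fun k τ => ?_) T).trans_eq ?_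
    · have hmem : ∀ p ∈ (A ×ˢ B).filter fun p => p.1 + p.2 = k ∧
          τ ≤ σ₂ * jbZ p.1 + σ₂ * jbZ p.2 ∧ σ₂ * jbZ p.1 + σ₂ * jbZ p.2 ≤ τ + 1,
          p ∈ A ×ˢ B ∧ p.2 = k - p.1 := fun p hp => by
        obtain ⟨h1, h2, -⟩ := Finset.mem_filter.1 hp
        exact ⟨h1, by rw [← h2, add_sub_cancel_left]⟩
      refine card_pairs_window_le hM hL q k hσ₁ τ _ (fun p hp => hA _ (hAP p (hmem p hp).1))
        (fun p hp => hq _ (hAP p (hmem p hp).1)) (fun p hp i => ?_) (fun p hp p' hp' h => ?_)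
        (fun p hp => by rw [(hmem p hp).2]) (fun p hp => (Finset.mem_filter.1 hp).2.2)
      · rw [← (Finset.mem_filter.1 hp).2.1, Pi.add_apply, Int.cast_add]
        obtain ⟨h1, h2⟩ := hcoord p (hmem p hp).1 i
        exact (abs_add_le _ _).trans (by linarith)
      · refine Prod.ext h ?_
        rw [(hmem p hp).2, (hmem p' hp').2, h]
    · simp only [norm_mul, mul_pow, Finset.sum_product, Finset.sum_mul_sum]
  · have hσ' : σ₂ = -σ₁ := by
      rcases hσ₁ with rfl | rfl <;> rcases hσ₂ with rfl | rfl <;> simp_all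
    subst hσ'
    have hflip : ∀ t : ℝ, ∑ k ∈ (A ×ˢ B).image (fun p => p.1 + p.2),
        ‖∑ p ∈ A ×ˢ B with p.1 + p.2 = k, a p.1 * b p.2 *
          Complex.exp (Complex.I * ((t * (σ₁ * jbZ p.1 + -σ₁ * jbZ p.2) : ℝ) : ℂ))‖ ^ 2 =
        ∑ k ∈ (A ×ˢ B).image (fun p => p.1 - p.2),
        ‖∑ p ∈ A ×ˢ B with p.1 - p.2 = k, a p.1 * (starRingEnd ℂ) (b p.2) *
          Complex.exp (Complex.I * ((t * (σ₁ * jbZ p.1 + σ₁ * jbZ p.2) : ℝ) : ℂ))‖ ^ 2 := by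
      intro t
      have h := sum_norm_sq_add_eq_sub A B
        (fun m => a m * Complex.exp (Complex.I * ((t * (σ₁ * jbZ m) : ℝ) : ℂ)))
        (fun n => b n * Complex.exp (Complex.I * ((t * (-σ₁ * jbZ n) : ℝ) : ℂ)))
      have e1 : ∀ p : (Fin 3 → ℤ) × (Fin 3 → ℤ),
          a p.1 * Complex.exp (Complex.I * ((t * (σ₁ * jbZ p.1) : ℝ) : ℂ)) *
            (b p.2 * Complex.exp (Complex.I * ((t * (-σ₁ * jbZ p.2) : ℝ) : ℂ))) =
          a p.1 * b p.2 *
            Complex.exp (Complex.I * ((t * (σ₁ * jbZ p.1 + -σ₁ * jbZ p.2) : ℝ) : ℂ)) := fun p => by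
        rw [mul_add t, Complex.ofReal_add, mul_add Complex.I, Complex.exp_add]
        ring
      have e2 : ∀ p : (Fin 3 → ℤ) × (Fin 3 → ℤ),
          a p.1 * Complex.exp (Complex.I * ((t * (σ₁ * jbZ p.1) : ℝ) : ℂ)) *
            (starRingEnd ℂ)
              (b p.2 * Complex.exp (Complex.I * ((t * (-σ₁ * jbZ p.2) : ℝ) : ℂ))) =
          a p.1 * (starRingEnd ℂ) (b p.2) *
            Complex.exp (Complex.I * ((t * (σ₁ * jbZ p.1 + σ₁ * jbZ p.2) : ℝ) : ℂ)) := fun p => by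
        rw [mul_add t, Complex.ofReal_add, mul_add Complex.I, Complex.exp_add, map_mul,
          ← Complex.exp_conj, map_mul, Complex.conj_I, Complex.conj_ofReal,
          show t * (-σ₁ * jbZ p.2) = -(t * (σ₁ * jbZ p.2)) by ring, Complex.ofReal_neg, neg_mul_neg]
        ring
      simpa only [e1, e2] using h
    simp_rw [hflip]
    refine (lintegral_fiber_exp_sum_le (A ×ˢ B) (fun p => p.1 - p.2)
      (fun p => a p.1 * (starRingEnd ℂ) (b p.2))
      (fun p => σ₁ * jbZ p.1 + σ₁ * jbZ p.2) (K := 19200000 * (M * L)) (fun k τ => ?_) T).trans_eq ?_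
    · have hmem : ∀ p ∈ (A ×ˢ B).filter fun p => p.1 - p.2 = k ∧
          τ ≤ σ₁ * jbZ p.1 + σ₁ * jbZ p.2 ∧ σ₁ * jbZ p.1 + σ₁ * jbZ p.2 ≤ τ + 1,
          p ∈ A ×ˢ B ∧ p.2 = p.1 - k := fun p hp => by
        obtain ⟨h1, h2, -⟩ := Finset.mem_filter.1 hp
        exact ⟨h1, by rw [← h2, sub_sub_cancel]⟩
      refine card_pairs_window_le hM hL q k hσ₁ τ _ (fun p hp => hA _ (hAP p (hmem p hp).1))
        (fun p hp => hq _ (hAP p (hmem p hp).1)) (fun p hp i => ?_) (fun p hp p' hp' h => ?_)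
        (fun p hp => by rw [(hmem p hp).2, jbZ_sub_comm])
        (fun p hp => (Finset.mem_filter.1 hp).2.2)
      · rw [← (Finset.mem_filter.1 hp).2.1, Pi.sub_apply, Int.cast_sub]
        obtain ⟨h1, h2⟩ := hcoord p (hmem p hp).1 i
        exact (abs_sub _ _).trans (by linarith)
      · refine Prod.ext h ?_
        rw [(hmem p hp).2, (hmem p' hp').2, h]
    · simp only [norm_mul, mul_pow, RCLike.norm_conj, Finset.sum_product, Finset.sum_mul_sum]

lemma eLpNorm_two_le_of_lintegral_le {α : Type*} [MeasurableSpace α] {μ : Measure α} {f : α → ℂ}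
    {Y : ℝ} (hY : 0 ≤ Y) (h : ∫⁻ x, ENNReal.ofReal (‖f x‖ ^ 2) ∂μ ≤ ENNReal.ofReal Y) :
    eLpNorm f 2 μ ≤ ENNReal.ofReal √Y := by
  rw [eLpNorm_eq_lintegral_rpow_enorm_toReal two_ne_zero ENNReal.ofNat_ne_top, Real.sqrt_eq_rpow,
    ← ENNReal.ofReal_rpow_of_nonneg hY (by norm_num)]
  simp only [ENNReal.toReal_ofNat, ENNReal.rpow_two]
  gcongr
  simpa only [ENNReal.ofReal_pow (norm_nonneg _), ofReal_norm] using h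

/-- The cell of side `L` containing a lattice point. -/
noncomputable def cellIndex (L : ℝ) (m : Fin 3 → ℤ) : Fin 3 → ℤ := fun i => ⌊(m i : ℝ) / L⌋

lemma cellIndex_add_mem {L : ℝ} (hL : 0 < L) (m n : Fin 3 → ℤ) (h : normZ (m + n) < 2 * L) :
    cellIndex L n + cellIndex L m ∈ Finset.Icc (fun _ => -3 : Fin 3 → ℤ) (fun _ => 1) := by
  have hi : ∀ i, -3 ≤ ⌊(n i : ℝ) / L⌋ + ⌊(m i : ℝ) / L⌋ ∧ ⌊(n i : ℝ) / L⌋ + ⌊(m i : ℝ) / L⌋ ≤ 1 := by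
    intro i
    have h0 := abs_lt.1 ((abs_coord_le_normZ (m + n) i).trans_lt h)
    rw [Pi.add_apply, Int.cast_add] at h0
    have h1 : (m i : ℝ) / L + n i / L < 2 := by
      rw [← add_div, div_lt_iff₀ hL]
      exact h0.2
    have h2 : -2 < (m i : ℝ) / L + n i / L := by
      rw [← add_div, lt_div_iff₀ hL]
      linarith [h0.1]
    have f1 := Int.floor_le ((m i : ℝ) / L)
    have f2 := Int.lt_floor_add_one ((m i : ℝ) / L)
    have f3 := Int.floor_le ((n i : ℝ) / L)
    have f4 := Int.lt_floor_add_one ((n i : ℝ) / L)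
    have g1 : ((⌊(n i : ℝ) / L⌋ + ⌊(m i : ℝ) / L⌋ : ℤ) : ℝ) < (2 : ℤ) := by push_cast; linarith
    have g2 : ((-4 : ℤ) : ℝ) < (⌊(n i : ℝ) / L⌋ + ⌊(m i : ℝ) / L⌋ : ℤ) := by push_cast; linarith
    rw [Int.cast_lt] at g1 g2
    constructor <;> omega
  exact Finset.mem_Icc.2 ⟨fun i => (hi i).1, fun i => (hi i).2⟩

lemma projProd_eq_sum_cells {L : ℝ} (hL : 0 < L) (S A B : Finset (Fin 3 → ℤ))
    (hS : ∀ k ∈ S, normZ k < 2 * L) (σ₁ σ₂ : ℝ) (a b : (Fin 3 → ℤ) → ℂ) (t : ℝ)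
    (x : Fin 3 → ℝ) :
    projProd S A B σ₁ σ₂ a b t x =
      ∑ q ∈ A.image (cellIndex L), ∑ d ∈ Finset.Icc (fun _ => -3 : Fin 3 → ℤ) (fun _ => 1),
        projProd S (A.filter fun m => cellIndex L m = q)
          (B.filter fun n => d - cellIndex L n = q) σ₁ σ₂ a b t x := by
  simp only [projProd]
  simp_rw [Finset.sum_comm (t := S), ← Finset.sum_mul]
  refine Finset.sum_congr rfl fun k hk => ?_
  congr 1
  rw [← Finset.sum_fiberwise_of_maps_to (g := cellIndex L) (t := A.image (cellIndex L))
    fun m hm => Finset.mem_image_of_mem _ hm]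
  refine Finset.sum_congr rfl fun q _ => ?_
  conv_rhs => rw [Finset.sum_comm]
  refine Finset.sum_congr rfl fun m hm => ?_
  simp_rw [Finset.sum_filter (s := B)]
  conv_rhs => rw [Finset.sum_comm]
  refine Finset.sum_congr rfl fun n _ => ?_
  simp_rw [sub_eq_iff_eq_add]
  rw [Finset.sum_ite_eq']
  split_ifs with h1 h2 h2
  · rfl
  · refine absurd ?_ h2
    rw [add_comm, ← (Finset.mem_filter.1 hm).2]
    exact cellIndex_add_mem hL m n (h1 ▸ hS k hk)
  · rfl
  · rfl

/-- The bilinear estimate, with the number of cell offsets as part of the constant. -/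
lemma eLpNorm_projProd_le {M L : ℝ} (hM : 1 ≤ M) (hL : 1 ≤ L)
    (S A B : Finset (Fin 3 → ℤ)) (hS : ∀ k ∈ S, normZ k < 2 * L)
    (hA : ∀ m ∈ A, M ≤ normZ m ∧ normZ m ≤ 2 * M) (hB : ∀ n ∈ B, normZ n ≤ 4 * M) {σ₁ σ₂ : ℝ}
    (hσ₁ : σ₁ = 1 ∨ σ₁ = -1) (hσ₂ : σ₂ = 1 ∨ σ₂ = -1) (a b : (Fin 3 → ℤ) → ℂ) (T : ℝ) :
    eLpNorm (fun p : ℝ × (Fin 3 → ℝ) => projProd S A B σ₁ σ₂ a b p.1 p.2) 2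
        (volume.restrict (Set.Icc 0 T ×ˢ cube)) ≤
      ENNReal.ofReal ((Finset.Icc (fun _ => -3 : Fin 3 → ℤ) (fun _ => 1)).card *
        (√((2 * Real.pi) ^ 3 * (sieveConst T * 19200000)) * √(M * L) *
          (√(∑ m ∈ A, ‖a m‖ ^ 2) * √(∑ n ∈ B, ‖b n‖ ^ 2)))) := by
  set D := Finset.Icc (fun _ => -3 : Fin 3 → ℤ) (fun _ => 1)
  set G := √((2 * Real.pi) ^ 3 * (sieveConst T * 19200000)) * √(M * L) with hG
  let Aq : (Fin 3 → ℤ) → Finset (Fin 3 → ℤ) := fun q => A.filter fun m => cellIndex L m = q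
  let Bq : (Fin 3 → ℤ) → (Fin 3 → ℤ) → Finset (Fin 3 → ℤ) :=
    fun d q => B.filter fun n => d - cellIndex L n = q
  have hsC := sieveConst_nonneg T
  have hlocal : ∀ q d, eLpNorm
      (fun p : ℝ × (Fin 3 → ℝ) => projProd S (Aq q) (Bq d q) σ₁ σ₂ a b p.1 p.2) 2
      (volume.restrict (Set.Icc 0 T ×ˢ cube)) ≤
      ENNReal.ofReal (G * (√(∑ m ∈ Aq q, ‖a m‖ ^ 2) * √(∑ n ∈ Bq d q, ‖b n‖ ^ 2))) := by
    intro q d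
    refine (eLpNorm_two_le_of_lintegral_le (by positivity) (lintegral_projProd_cell_le hM hL q S
      (Aq q) (Bq d q)
      (fun m hm => hA m (Finset.mem_filter.1 hm).1)
      (fun m hm i => congrFun (Finset.mem_filter.1 hm).2 i)
      (fun n hn => hB n (Finset.mem_filter.1 hn).1) hσ₁ hσ₂ a b T)).trans_eq ?_
    congr 1
    rw [hG, ← Real.sqrt_mul (by positivity), ← Real.sqrt_mul (by positivity),
      ← Real.sqrt_mul (by positivity)]
    congr 1
    generalize ∑ m ∈ Aq q, ‖a m‖ ^ 2 = U, ∑ n ∈ Bq d q, ‖b n‖ ^ 2 = V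
    ring
  have hfun : (fun p : ℝ × (Fin 3 → ℝ) => projProd S A B σ₁ σ₂ a b p.1 p.2) =
      ∑ d ∈ D, ∑ q ∈ A.image (cellIndex L),
        fun p : ℝ × (Fin 3 → ℝ) => projProd S (Aq q) (Bq d q) σ₁ σ₂ a b p.1 p.2 := by
    funext p
    simp only [Finset.sum_apply]
    rw [projProd_eq_sum_cells (by linarith) S A B hS, Finset.sum_comm]
  have hmeas : ∀ q d, AEStronglyMeasurable
      (fun p : ℝ × (Fin 3 → ℝ) => projProd S (Aq q) (Bq d q) σ₁ σ₂ a b p.1 p.2)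
      (volume.restrict (Set.Icc 0 T ×ˢ cube)) := fun q d =>
    (continuous_projProd _ _ _ _ _ _ _).aestronglyMeasurable
  have hCS : ∀ d ∈ D, ∑ q ∈ A.image (cellIndex L),
      √(∑ m ∈ Aq q, ‖a m‖ ^ 2) * √(∑ n ∈ Bq d q, ‖b n‖ ^ 2) ≤
      √(∑ m ∈ A, ‖a m‖ ^ 2) * √(∑ n ∈ B, ‖b n‖ ^ 2) := by
    intro d _
    refine (Real.sum_sqrt_mul_sqrt_le _ (fun q => by positivity) (fun q => by positivity)).trans ?_
    gcongr
    · exact (Finset.sum_fiberwise_of_maps_to (fun m hm => Finset.mem_image_of_mem _ hm) _).le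
    · rw [Finset.sum_fiberwise_eq_sum_filter]
      exact Finset.sum_le_sum_of_subset_of_nonneg (Finset.filter_subset _ _)
        fun n _ _ => by positivity
  rw [hfun]
  calc _ ≤ ∑ d ∈ D, ∑ q ∈ A.image (cellIndex L),
        ENNReal.ofReal (G * (√(∑ m ∈ Aq q, ‖a m‖ ^ 2) * √(∑ n ∈ Bq d q, ‖b n‖ ^ 2))) := by
        refine (eLpNorm_sum_le (fun d _ => Finset.aestronglyMeasurable_sum _ fun q _ => hmeas q d)
          one_le_two).trans (Finset.sum_le_sum fun d _ => ?_)
        exact (eLpNorm_sum_le (fun q _ => hmeas q d) one_le_two).trans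
          (Finset.sum_le_sum fun q _ => hlocal q d)
    _ = ENNReal.ofReal (∑ d ∈ D, ∑ q ∈ A.image (cellIndex L),
        G * (√(∑ m ∈ Aq q, ‖a m‖ ^ 2) * √(∑ n ∈ Bq d q, ‖b n‖ ^ 2))) := by
        rw [ENNReal.ofReal_sum_of_nonneg fun d _ => by positivity]
        refine Finset.sum_congr rfl fun d _ => ?_
        rw [ENNReal.ofReal_sum_of_nonneg fun q _ => by positivity]
    _ ≤ _ := by
        refine ENNReal.ofReal_le_ofReal ?_
        rw [← nsmul_eq_mul]
        refine Finset.sum_le_card_nsmul _ _ _ fun d hd => ?_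
        rw [← Finset.mul_sum]
        gcongr
        exact hCS d hd

lemma projProdWave_eq_zero {O M N : ℝ} (h : 2 * M + 2 * N < O) (σ₁ σ₂ : ℝ)
    (a b : (Fin 3 → ℤ) → ℂ) (t : ℝ) (x : Fin 3 → ℝ) :
    projProdWave O M N σ₁ σ₂ a b t x = 0 := by
  rw [projProdWave_eq_projProd, projProd]
  refine Finset.sum_eq_zero fun k hk => mul_eq_zero_of_left (Finset.sum_eq_zero fun m hm =>
    Finset.sum_eq_zero fun n hn => if_neg ?_) _
  rintro rfl
  linarith [normZ_add_le m n, (mem_annulus_bounds hk).1, (mem_annulus_bounds hm).2,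
    (mem_annulus_bounds hn).2]

/-- **Refined bilinear L² estimate for free Klein–Gordon waves, comparable frequencies**
(Proposition 5.2, second case).  For every `T > 0` there is `C_T > 0` such that for all
`M, N, O ≥ 1` with `N/2 ≤ M ≤ 2N`, all signs `σ₁, σ₂ ∈ {+1, -1}` and all coefficients
`(a(m))_{m ∈ S_M}`, `(b(n))_{n ∈ S_N}`, the free waves `u, v` satisfy
`‖P_O(uv)‖_{L²([0,T]×T³)} ≤ C_T max(O,M,N)^{1/2} min(O,M,N)^{1/2}
(∑|a(m)|²)^{1/2} (∑|b(n)|²)^{1/2}`. -/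
theorem bilinear_L2_comparable (T : ℝ) (hT : 0 < T) :
    ∃ C > (0:ℝ), ∀ M N O : ℝ, 1 ≤ M → 1 ≤ N → 1 ≤ O → N / 2 ≤ M → M ≤ 2 * N →
      ∀ σ₁ σ₂ : ℝ, (σ₁ = 1 ∨ σ₁ = -1) → (σ₂ = 1 ∨ σ₂ = -1) →
      ∀ a b : (Fin 3 → ℤ) → ℂ,
      eLpNorm (fun p : ℝ × (Fin 3 → ℝ) => projProdWave O M N σ₁ σ₂ a b p.1 p.2)
        2 (volume.restrict (Set.Icc 0 T ×ˢ cube)) ≤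
      ENNReal.ofReal (C * max O (max M N) ^ ((1:ℝ)/2) * min O (min M N) ^ ((1:ℝ)/2) *
        Real.sqrt (∑ m ∈ annulus M, ‖a m‖ ^ 2) * Real.sqrt (∑ n ∈ annulus N, ‖b n‖ ^ 2)) := by
  set D : ℝ := ((Finset.Icc (fun _ => -3 : Fin 3 → ℤ) (fun _ => 1)).card : ℝ) with hD
  set G : ℝ := √((2 * Real.pi) ^ 3 * (sieveConst T * 19200000)) with hG
  refine ⟨D * G * 3 + 1, by positivity, ?_⟩
  intro M N O hM hN hO hNM hMN σ₁ σ₂ hσ₁ hσ₂ a b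
  rcases lt_or_ge (2 * M + 2 * N) O with h | h
  · simp only [projProdWave_eq_zero h]
    simp
  · rw [projProdWave_eq_projProd]
    refine (eLpNorm_projProd_le hM hO _ _ _ (fun k hk => (mem_annulus_bounds hk).2)
      (fun m hm => ⟨(mem_annulus_bounds hm).1, (mem_annulus_bounds hm).2.le⟩)
      (fun n hn => (mem_annulus_bounds hn).2.le.trans (by linarith)) hσ₁ hσ₂ a b T).trans
      (ENNReal.ofReal_le_ofReal ?_)
    rw [← hD, ← hG, ← Real.sqrt_eq_rpow, ← Real.sqrt_eq_rpow]
    have hmax : M ≤ max O (max M N) := le_max_of_le_right (le_max_left _ _)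
    have hmin : O ≤ 9 * min O (min M N) := by
      rw [mul_min_of_nonneg _ _ (by norm_num), mul_min_of_nonneg _ _ (by norm_num)]
      exact le_min (by linarith) (le_min (by linarith) (by linarith))
    have hmin0 : 0 ≤ min O (min M N) := by linarith
    have hMO : √(M * O) ≤ 3 * (√(max O (max M N)) * √(min O (min M N))) := by
      rw [← Real.sqrt_mul (by linarith)]
      refine Real.sqrt_le_iff.2 ⟨by positivity, ?_⟩
      rw [mul_pow, Real.sq_sqrt (mul_nonneg (by linarith) hmin0)]
      calc M * O ≤ max O (max M N) * (9 * min O (min M N)) := by gcongr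
        _ = _ := by ring
    calc D * (G * √(M * O) * (√(∑ m ∈ annulus M, ‖a m‖ ^ 2) * √(∑ n ∈ annulus N, ‖b n‖ ^ 2)))
        ≤ D * (G * (3 * (√(max O (max M N)) * √(min O (min M N)))) *
          (√(∑ m ∈ annulus M, ‖a m‖ ^ 2) * √(∑ n ∈ annulus N, ‖b n‖ ^ 2))) := by gcongr
      _ = D * G * 3 * √(max O (max M N)) * √(min O (min M N)) *
          √(∑ m ∈ annulus M, ‖a m‖ ^ 2) * √(∑ n ∈ annulus N, ‖b n‖ ^ 2) := by ring
      _ ≤ _ := by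
        gcongr
        linarith
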